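/- arXiv:2303.01208 — 2 statements merged into one kernel-verified Lean document; each statement's English description precedes it below -/
import Mathlib

section
/- Let Ω ⊆ ℝⁿ be a nonempty, open and convex set, and let φ₁, φ₂ be Schwartz functions whose Fourier transforms have compact support. Set φ = φ₁ + φ₂ and D_{φ_i} = (supp 𝓕φ_i − Ω) ∩ Ω for i = 1, 2. If D_{φ₁} ∩ D_{φ₂} = ∅, then ‖H_φ‖ = max(‖H_{φ₁}‖, ‖H_{φ₂}‖). -/
open MeasureTheory Real Set Metric
open scoped ENNReal FourierTransform RealInnerProductSpace SchwartzMap Pointwise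

noncomputable section

/-- The (Fourier-side) Hankel operator norm `‖H_φ‖` of the Hankel operator with symbol `φ`
on the Paley–Wiener space `PW(Ω)`.  An element `f ∈ L²` with `𝓕f` smooth and compactly
supported in `Ω` is (by Fourier inversion) a Schwartz function with `supp 𝓕f ⊆ Ω` compact;
by Plancherel, `‖f‖₂ = ‖𝓕f‖₂` and `‖H_φ f‖₂` is the `L²`-norm of
`x ↦ 1_Ω(x) ∫_Ω 𝓕f(y) 𝓕φ(x+y) dy`, which is `𝓕(H_φ f)`. -/
def hankelNorm (n : ℕ) (Ω : Set (EuclideanSpace ℝ (Fin n)))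
    (φ : 𝓢(EuclideanSpace ℝ (Fin n), ℂ)) : ℝ≥0∞ :=
  ⨆ f : {f : 𝓢(EuclideanSpace ℝ (Fin n), ℂ) //
      HasCompactSupport (𝓕 ⇑f) ∧ tsupport (𝓕 ⇑f) ⊆ Ω},
    eLpNorm (Ω.indicator fun x => ∫ y in Ω, 𝓕 ⇑(f : 𝓢(EuclideanSpace ℝ (Fin n), ℂ)) y
        * 𝓕 ⇑φ (x + y)) 2 volume
      / eLpNorm ⇑(f : 𝓢(EuclideanSpace ℝ (Fin n), ℂ)) 2 volume

/-- `𝓕ψ = 𝓕φ` on `2Ω`, as tempered distributions: for every smooth function `g` compactly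
supported in `2Ω`, `⟨𝓕ψ, g⟩ = ⟨ψ, 𝓕g⟩` agrees with `⟨𝓕φ, g⟩`. -/
def FourierAgreesOn (n : ℕ) (Ω : Set (EuclideanSpace ℝ (Fin n)))
    (φ : 𝓢(EuclideanSpace ℝ (Fin n), ℂ)) (ψ : EuclideanSpace ℝ (Fin n) → ℂ) : Prop :=
  ∀ g : EuclideanSpace ℝ (Fin n) → ℂ, ContDiff ℝ (⊤ : ℕ∞) g → HasCompactSupport g →
    tsupport g ⊆ (2 : ℝ) • Ω →
      ∫ x, ψ x * 𝓕 g x = ∫ x, 𝓕 ⇑φ x * g x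

/-- The Hankel operator with kernel `u` on the Fourier side, acting on `g`. -/
def hankelFourier {n : ℕ} (Ω : Set (EuclideanSpace ℝ (Fin n)))
    (u g : EuclideanSpace ℝ (Fin n) → ℂ) : EuclideanSpace ℝ (Fin n) → ℂ :=
  Ω.indicator fun x => ∫ y in Ω, g y * u (x + y)

section

variable {n : ℕ} {Ω : Set (EuclideanSpace ℝ (Fin n))}

lemma eLpNorm_fourier_schwartz (f : 𝓢(EuclideanSpace ℝ (Fin n), ℂ)) :
    eLpNorm (𝓕 ⇑f) 2 volume = eLpNorm ⇑f 2 volume := by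
  have h := SchwartzMap.norm_fourier_toL2_eq f
  rw [SchwartzMap.norm_toLp, SchwartzMap.norm_toLp, SchwartzMap.fourier_coe] at h
  refine (ENNReal.toReal_eq_toReal_iff' ?_ ?_).1 h
  · rw [← SchwartzMap.fourier_coe]
    exact ((𝓕 f).eLpNorm_lt_top 2 volume).ne
  · exact (f.eLpNorm_lt_top 2 volume).ne

lemma eLpNorm_hankelFourier_le (φ f : 𝓢(EuclideanSpace ℝ (Fin n), ℂ))
    (hf : HasCompactSupport (𝓕 ⇑f)) (hfΩ : tsupport (𝓕 ⇑f) ⊆ Ω) :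
    eLpNorm (hankelFourier Ω (𝓕 ⇑φ) (𝓕 ⇑f)) 2 volume
      ≤ hankelNorm n Ω φ * eLpNorm (𝓕 ⇑f) 2 volume := by
  rw [eLpNorm_fourier_schwartz f]
  by_cases h0 : eLpNorm ⇑f 2 volume = 0
  · have hz : 𝓕 ⇑f = 0 := by
      have hc : Continuous (𝓕 ⇑f) := by
        rw [← SchwartzMap.fourier_coe]
        exact (𝓕 f).continuous
      rw [← eLpNorm_fourier_schwartz f,
        eLpNorm_eq_zero_iff hc.aestronglyMeasurable two_ne_zero] at h0
      exact (hc.ae_eq_iff_eq volume continuous_const).1 h0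
    have : hankelFourier Ω (𝓕 ⇑φ) (𝓕 ⇑f) = 0 := by
      ext x
      simp [hankelFourier, hz]
    simp [this]
  · rw [← ENNReal.div_le_iff h0 (f.eLpNorm_lt_top 2 volume).ne]
    exact le_iSup (fun f : {f : 𝓢(EuclideanSpace ℝ (Fin n), ℂ) //
      HasCompactSupport (𝓕 ⇑f) ∧ tsupport (𝓕 ⇑f) ⊆ Ω} =>
        eLpNorm (hankelFourier Ω (𝓕 ⇑φ) (𝓕 ⇑(f : 𝓢(EuclideanSpace ℝ (Fin n), ℂ)))) 2 volume
          / eLpNorm ⇑(f : 𝓢(EuclideanSpace ℝ (Fin n), ℂ)) 2 volume) ⟨f, hf, hfΩ⟩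

lemma eLpNorm_hankelFourier_le_of_contDiff (φ : 𝓢(EuclideanSpace ℝ (Fin n), ℂ))
    {g : EuclideanSpace ℝ (Fin n) → ℂ} (hg : ContDiff ℝ (⊤ : ℕ∞) g)
    (hgc : HasCompactSupport g) (hgΩ : tsupport g ⊆ Ω) :
    eLpNorm (hankelFourier Ω (𝓕 ⇑φ) g) 2 volume
      ≤ hankelNorm n Ω φ * eLpNorm g 2 volume := by
  let f : 𝓢(EuclideanSpace ℝ (Fin n), ℂ) := 𝓕⁻ (hgc.toSchwartzMap hg)
  have h : 𝓕 ⇑f = g := by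
    rw [← SchwartzMap.fourier_coe, FourierTransform.fourier_fourierInv_eq]
    rfl
  have := eLpNorm_hankelFourier_le (Ω := Ω) φ f
  rw [h] at this
  exact this hgc hgΩ

lemma aestronglyMeasurable_hankelFourier (hΩ : MeasurableSet Ω)
    {u g : EuclideanSpace ℝ (Fin n) → ℂ} (hu : Continuous u) (hg : Continuous g) :
    AEStronglyMeasurable (hankelFourier Ω u g) volume := by
  refine AEStronglyMeasurable.indicator ?_ hΩ
  have : StronglyMeasurable
      (fun p : EuclideanSpace ℝ (Fin n) × EuclideanSpace ℝ (Fin n) => g p.2 * u (p.1 + p.2)) :=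
    Continuous.stronglyMeasurable (by fun_prop)
  exact this.integral_prod_right'.aestronglyMeasurable

/-- If the kernel only sees the open set `S`, the norm bound on smooth functions improves to a bound
by the norm of the restriction to `S`. -/
lemma eLpNorm_hankelFourier_le_indicator (hΩ : MeasurableSet Ω)
    (φ : 𝓢(EuclideanSpace ℝ (Fin n), ℂ)) {S : Set (EuclideanSpace ℝ (Fin n))} (hS : IsOpen S)
    (hφS : ∀ x ∈ Ω, ∀ y ∈ Ω, y ∉ S → 𝓕 ⇑φ (x + y) = 0)
    {g : EuclideanSpace ℝ (Fin n) → ℂ} (hg : ContDiff ℝ (⊤ : ℕ∞) g)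
    (hgc : HasCompactSupport g) (hgΩ : tsupport g ⊆ Ω) :
    eLpNorm (hankelFourier Ω (𝓕 ⇑φ) g) 2 volume
      ≤ hankelNorm n Ω φ * eLpNorm (S.indicator g) 2 volume := by
  have hu : Continuous (𝓕 ⇑φ) := by
    rw [← SchwartzMap.fourier_coe]
    exact (𝓕 φ).continuous
  obtain ⟨C, hC⟩ : ∃ C, ∀ x, ‖𝓕 ⇑φ x‖ ≤ C := by
    rw [← SchwartzMap.fourier_coe]
    exact ⟨_, SchwartzMap.norm_le_seminorm ℝ (𝓕 φ)⟩
  obtain ⟨χ, hχS, hχ, hχr⟩ := hS.exists_contDiff_support_eq (n := ⊤)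
  have hχ01 (x) : 0 ≤ χ x ∧ χ x ≤ 1 := hχr (mem_range_self x)
  let c (k : ℕ) (x : EuclideanSpace ℝ (Fin n)) : ℝ := 1 - (1 - χ x) ^ k
  have hc01 (k x) : |c k x| ≤ 1 := by
    have h0 : 0 ≤ (1 - χ x) ^ k := pow_nonneg (by linarith [(hχ01 x).2]) k
    have h1 : (1 - χ x) ^ k ≤ 1 :=
      pow_le_one₀ (by linarith [(hχ01 x).2]) (by linarith [(hχ01 x).1])
    simp only [c]
    rw [abs_le]
    constructor <;> linarith
  have hc0 (k) {x} (hx : x ∉ S) : c k x = 0 := by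
    have : χ x = 0 := by simpa [← hχS] using hx
    simp [c, this]
  have hclim {x} (hx : x ∈ S) : Filter.Tendsto (c · x) Filter.atTop (nhds 1) := by
    have h0 : 0 < χ x := (hχ01 x).1.lt_of_ne' (by rwa [← hχS] at hx)
    simpa [c] using (tendsto_pow_atTop_nhds_zero_of_lt_one
      (by linarith [(hχ01 x).2]) (by linarith : 1 - χ x < 1)).const_sub 1
  let G (k : ℕ) (x : EuclideanSpace ℝ (Fin n)) : ℂ := (c k x : ℂ) * g x
  have hG (k) : ContDiff ℝ (⊤ : ℕ∞) (G k) :=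
    (Complex.ofRealCLM.contDiff.comp (contDiff_const.sub ((contDiff_const.sub hχ).pow k))).mul hg
  have hGn (k x) : ‖G k x‖ ≤ ‖g x‖ := by
    simp only [G, norm_mul, Complex.norm_real, Real.norm_eq_abs]
    exact mul_le_of_le_one_left (norm_nonneg _) (hc01 k x)
  have hGS (k) : eLpNorm (G k) 2 volume ≤ eLpNorm (S.indicator g) 2 volume := by
    refine eLpNorm_mono fun x => ?_
    by_cases hx : x ∈ S
    · simpa [hx] using hGn k x
    · simp [G, hc0 k hx]
  have hbound (k) : eLpNorm (hankelFourier Ω (𝓕 ⇑φ) (G k)) 2 volume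
      ≤ hankelNorm n Ω φ * eLpNorm (S.indicator g) 2 volume :=
    (eLpNorm_hankelFourier_le_of_contDiff φ (hG k) hgc.mul_left
      ((tsupport_mul_subset_right).trans hgΩ)).trans (by gcongr; exact hGS k)
  refine (Lp.eLpNorm_lim_le_liminf_eLpNorm
    (fun k => aestronglyMeasurable_hankelFourier hΩ hu (hG k).continuous) _
    (Filter.Eventually.of_forall fun x => ?_)).trans
    (Filter.liminf_le_of_frequently_le' (Filter.Frequently.of_forall hbound))
  by_cases hx : x ∈ Ω
  swap
  · simp [hankelFourier, hx]
  simp only [hankelFourier, indicator_of_mem hx]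
  have hgi : Integrable g volume := hg.continuous.integrable_of_hasCompactSupport hgc
  refine tendsto_integral_of_dominated_convergence (fun y => ‖g y‖ * C)
    (fun k => ?_) (hgi.norm.mul_const C).integrableOn (fun k => ?_) ?_
  · have := (hG k).continuous
    exact Continuous.aestronglyMeasurable (by fun_prop)
  · refine Filter.Eventually.of_forall fun y => ?_
    rw [norm_mul]
    exact mul_le_mul (hGn k y) (hC _) (norm_nonneg _) (norm_nonneg _)
  · filter_upwards [ae_restrict_mem hΩ] with y hy
    by_cases hyS : y ∈ S
    · have h1 : Filter.Tendsto (fun k => (c k y : ℂ)) Filter.atTop (nhds ((1 : ℝ) : ℂ)) :=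
        (Complex.continuous_ofReal.tendsto 1).comp (hclim hyS)
      simpa [G] using (h1.mul_const (g y)).mul_const (𝓕 ⇑φ (x + y))
    · simp [hφS x hx y hy hyS]

lemma eLpNorm_two_sq (F : EuclideanSpace ℝ (Fin n) → ℂ) :
    eLpNorm F 2 volume ^ 2 = ∫⁻ x, ‖F x‖ₑ ^ 2 := by
  simpa using eLpNorm_nnreal_pow_eq_lintegral (f := F) (μ := volume) (p := 2) two_ne_zero

lemma eLpNorm_sq_add_of_disjoint {F₁ F₂ : EuclideanSpace ℝ (Fin n) → ℂ}
    (hF₁ : AEStronglyMeasurable F₁ volume) (h : ∀ x, F₁ x = 0 ∨ F₂ x = 0) :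
    eLpNorm (F₁ + F₂) 2 volume ^ 2 = eLpNorm F₁ 2 volume ^ 2 + eLpNorm F₂ 2 volume ^ 2 := by
  simp only [eLpNorm_two_sq]
  rw [← lintegral_add_left' (hF₁.enorm.pow_const 2)]
  refine lintegral_congr fun x => ?_
  rcases h x with h | h <;> simp [h]

lemma eLpNorm_indicator_sq_add_le {S T : Set (EuclideanSpace ℝ (Fin n))} (hS : MeasurableSet S)
    (hST : S ∩ T = ∅) {g : EuclideanSpace ℝ (Fin n) → ℂ} (hg : Continuous g) :
    eLpNorm (S.indicator g) 2 volume ^ 2 + eLpNorm (T.indicator g) 2 volume ^ 2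
      ≤ eLpNorm g 2 volume ^ 2 := by
  have hdis : Disjoint S T := disjoint_iff_inter_eq_empty.2 hST
  rw [← eLpNorm_sq_add_of_disjoint (hg.aestronglyMeasurable.indicator hS)]
  · have hU : S.indicator g + T.indicator g = (S ∪ T).indicator g :=
      (indicator_union_of_disjoint hdis g).symm
    rw [hU]
    gcongr
    exact eLpNorm_indicator_le g
  · intro x
    by_cases hx : x ∈ S
    · exact .inr (indicator_of_notMem (hdis.notMem_of_mem_left hx) g)
    · exact .inl (indicator_of_notMem hx g)

end

/-- If `φ = φ₁ + φ₂` with `D_{φ₁} = (supp 𝓕φ₁ − Ω) ∩ Ω` and `D_{φ₂}` disjoint, then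
`‖H_φ‖ = max(‖H_{φ₁}‖, ‖H_{φ₂}‖)`. -/
theorem hankelNorm_add_of_disjoint
    (n : ℕ) (Ω : Set (EuclideanSpace ℝ (Fin n)))
    (hne : Ω.Nonempty) (hop : IsOpen Ω) (hconv : Convex ℝ Ω)
    (φ₁ φ₂ : 𝓢(EuclideanSpace ℝ (Fin n), ℂ))
    (h₁ : HasCompactSupport (𝓕 ⇑φ₁)) (h₂ : HasCompactSupport (𝓕 ⇑φ₂))
    (hdisj : ((tsupport (𝓕 ⇑φ₁) - Ω) ∩ Ω) ∩ ((tsupport (𝓕 ⇑φ₂) - Ω) ∩ Ω) = ∅) :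
    hankelNorm n Ω (φ₁ + φ₂) = max (hankelNorm n Ω φ₁) (hankelNorm n Ω φ₂) := by
  have hzero (φ : 𝓢(EuclideanSpace ℝ (Fin n), ℂ)) (x) (hx : x ∈ Ω) (y) (hy : y ∈ Ω)
      (h : x ∉ (tsupport (𝓕 ⇑φ) - Ω) ∩ Ω) : 𝓕 ⇑φ (x + y) = 0 := by
    by_contra hne
    exact h ⟨⟨x + y, subset_tsupport _ hne, y, hy, add_sub_cancel_right x y⟩, hx⟩
  have hzero' (φ : 𝓢(EuclideanSpace ℝ (Fin n), ℂ)) (x) (hx : x ∈ Ω) (y) (hy : y ∈ Ω)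
      (h : y ∉ (tsupport (𝓕 ⇑φ) - Ω) ∩ Ω) : 𝓕 ⇑φ (x + y) = 0 := by
    rw [add_comm]
    exact hzero φ y hy x hx h
  have hcont (φ : 𝓢(EuclideanSpace ℝ (Fin n), ℂ)) : Continuous (𝓕 ⇑φ) := by
    rw [← SchwartzMap.fourier_coe]
    exact (𝓕 φ).continuous
  have hopen (φ : 𝓢(EuclideanSpace ℝ (Fin n), ℂ)) :
      IsOpen ((tsupport (𝓕 ⇑φ) - Ω) ∩ Ω) := hop.sub_left.inter hop
  have hsum : 𝓕 ⇑(φ₁ + φ₂) = fun x => 𝓕 ⇑φ₁ x + 𝓕 ⇑φ₂ x := by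
    simp only [← SchwartzMap.fourier_coe, FourierTransform.fourier_add]
    rfl
  have hor (x : EuclideanSpace ℝ (Fin n)) (hx : x ∈ Ω) :
      (∀ y ∈ Ω, 𝓕 ⇑φ₁ (x + y) = 0) ∨ (∀ y ∈ Ω, 𝓕 ⇑φ₂ (x + y) = 0) := by
    by_cases h : x ∈ (tsupport (𝓕 ⇑φ₁) - Ω) ∩ Ω
    · exact .inr fun y hy => hzero φ₂ x hx y hy
        fun h' => (eq_empty_iff_forall_notMem.1 hdisj x) ⟨h, h'⟩
    · exact .inl fun y hy => hzero φ₁ x hx y hy h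
  have hint0 (u g : EuclideanSpace ℝ (Fin n) → ℂ) (x : EuclideanSpace ℝ (Fin n))
      (h : ∀ y ∈ Ω, u (x + y) = 0) : ∫ y in Ω, g y * u (x + y) = 0 :=
    setIntegral_eq_zero_of_forall_eq_zero fun y hy => by simp [h y hy]
  have hdisjF (g : EuclideanSpace ℝ (Fin n) → ℂ) (x : EuclideanSpace ℝ (Fin n)) :
      hankelFourier Ω (𝓕 ⇑φ₁) g x = 0 ∨ hankelFourier Ω (𝓕 ⇑φ₂) g x = 0 := by
    by_cases hx : x ∈ Ω
    · simp only [hankelFourier, indicator_of_mem hx]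
      exact (hor x hx).imp (hint0 _ g x) (hint0 _ g x)
    · simp [hankelFourier, hx]
  have hadd (g : EuclideanSpace ℝ (Fin n) → ℂ) : hankelFourier Ω (𝓕 ⇑(φ₁ + φ₂)) g
      = hankelFourier Ω (𝓕 ⇑φ₁) g + hankelFourier Ω (𝓕 ⇑φ₂) g := by
    ext x
    by_cases hx : x ∈ Ω
    · simp only [hankelFourier, Pi.add_apply, indicator_of_mem hx, hsum]
      rcases hor x hx with h | h
      · rw [hint0 _ g x h, zero_add]
        exact setIntegral_congr_fun hop.measurableSet fun y hy => by simp [h y hy]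
      · rw [hint0 _ g x h, add_zero]
        exact setIntegral_congr_fun hop.measurableSet fun y hy => by simp [h y hy]
    · simp [hankelFourier, hx]
  have hpyth {g : EuclideanSpace ℝ (Fin n) → ℂ} (hg : Continuous g) :
      eLpNorm (hankelFourier Ω (𝓕 ⇑(φ₁ + φ₂)) g) 2 volume ^ 2
        = eLpNorm (hankelFourier Ω (𝓕 ⇑φ₁) g) 2 volume ^ 2
          + eLpNorm (hankelFourier Ω (𝓕 ⇑φ₂) g) 2 volume ^ 2 := by
    rw [hadd]
    exact eLpNorm_sq_add_of_disjoint
      (aestronglyMeasurable_hankelFourier hop.measurableSet (hcont φ₁) hg) (hdisjF g)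
  apply le_antisymm
  · refine iSup_le fun ⟨f, hfc, hfΩ⟩ => ENNReal.div_le_of_le_mul ?_
    have hf : ContDiff ℝ (⊤ : ℕ∞) (𝓕 ⇑f) := by
      rw [← SchwartzMap.fourier_coe]
      exact (𝓕 f).smooth _
    rw [← eLpNorm_fourier_schwartz f, ← ENNReal.pow_le_pow_left_iff two_ne_zero, mul_pow]
    refine (hpyth (hcont f)).trans_le ?_
    calc _ ≤ (hankelNorm n Ω φ₁ * eLpNorm
              (((tsupport (𝓕 ⇑φ₁) - Ω) ∩ Ω).indicator (𝓕 ⇑f)) 2 volume) ^ 2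
            + (hankelNorm n Ω φ₂ * eLpNorm
              (((tsupport (𝓕 ⇑φ₂) - Ω) ∩ Ω).indicator (𝓕 ⇑f)) 2 volume) ^ 2 := by
          gcongr
          · exact eLpNorm_hankelFourier_le_indicator hop.measurableSet φ₁ (hopen φ₁)
              (hzero' φ₁) hf hfc hfΩ
          · exact eLpNorm_hankelFourier_le_indicator hop.measurableSet φ₂ (hopen φ₂)
              (hzero' φ₂) hf hfc hfΩ
      _ ≤ max (hankelNorm n Ω φ₁) (hankelNorm n Ω φ₂) ^ 2
            * (eLpNorm (((tsupport (𝓕 ⇑φ₁) - Ω) ∩ Ω).indicator (𝓕 ⇑f)) 2 volume ^ 2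
              + eLpNorm (((tsupport (𝓕 ⇑φ₂) - Ω) ∩ Ω).indicator (𝓕 ⇑f)) 2 volume ^ 2) := by
          rw [mul_pow, mul_pow, mul_add]
          gcongr
          · exact le_max_left _ _
          · exact le_max_right _ _
      _ ≤ _ := by
          gcongr
          exact eLpNorm_indicator_sq_add_le (hopen φ₁).measurableSet hdisj (hcont f)
  · refine max_le (iSup_mono fun f => ENNReal.div_le_div_right ?_ _)
      (iSup_mono fun f => ENNReal.div_le_div_right ?_ _)
    all_goals
      rw [← ENNReal.pow_le_pow_left_iff two_ne_zero]
      refine le_trans ?_ (hpyth (hcont f.1)).ge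
    · exact le_self_add
    · exact le_add_self
end
end

section
/- Every closed convex subset K of ℝ² having only finitely many extreme points is a polyhedron, i.e., K is an intersection of finitely many closed half-planes (with the convention that ℝ² itself is the intersection of the empty family of half-planes). -/
open Set
open scoped RealInnerProductSpace

section Barrier

variable {E : Type*} [NormedAddCommGroup E] [InnerProductSpace ℝ E]

/-- The barrier cone of `K`: the vectors `a` such that `⟪·, a⟫` is bounded above on `K`. -/
def barrierCone (K : Set E) : Set E :=
  {a | ∃ c : ℝ, ∀ x ∈ K, ⟪x, a⟫ ≤ c}

theorem smul_mem_barrierCone {K : Set E} {a : E} (ha : a ∈ barrierCone K) {r : ℝ} (hr : 0 ≤ r) :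
    r • a ∈ barrierCone K := by
  obtain ⟨c, hc⟩ := ha
  refine ⟨r * c, fun x hx => ?_⟩
  rw [real_inner_smul_right]
  exact mul_le_mul_of_nonneg_left (hc x hx) hr

theorem convex_barrierCone (K : Set E) : Convex ℝ (barrierCone K) := by
  rintro a ha b hb r s hr hs -
  obtain ⟨c, hc⟩ := smul_mem_barrierCone ha hr
  obtain ⟨d, hd⟩ := smul_mem_barrierCone hb hs
  refine ⟨c + d, fun x hx => ?_⟩
  rw [inner_add_right]
  exact add_le_add (hc x hx) (hd x hx)

theorem exists_separating_inner [CompleteSpace E] {K : Set E} (hK : IsClosed K)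
    (hconv : Convex ℝ K) {y : E} (hy : y ∉ K) :
    ∃ (a : E) (c : ℝ), (∀ x ∈ K, ⟪x, a⟫ ≤ c) ∧ c < ⟪y, a⟫ := by
  obtain ⟨f, u, hu, huy⟩ := geometric_hahn_banach_closed_point hconv hK hy
  have hf (x : E) : ⟪x, (InnerProductSpace.toDual ℝ E).symm f⟫ = f x := by
    rw [real_inner_comm, InnerProductSpace.toDual_symm_apply]
  exact ⟨(InnerProductSpace.toDual ℝ E).symm f, u, fun x hx => by rw [hf]; exact (hu x hx).le,
    by rwa [hf]⟩

/-- The separating functional can be taken in the interior of the barrier cone. -/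
theorem exists_separating_inner_mem_interior [CompleteSpace E] {K : Set E} (hK : IsClosed K)
    (hconv : Convex ℝ K) (hB : (interior (barrierCone K)).Nonempty) {y : E} (hy : y ∉ K) :
    ∃ a ∈ interior (barrierCone K), ∃ c : ℝ, (∀ x ∈ K, ⟪x, a⟫ ≤ c) ∧ c < ⟪y, a⟫ := by
  obtain ⟨a, c, hc, hcy⟩ := exists_separating_inner hK hconv hy
  obtain ⟨b, hb⟩ := hB
  obtain ⟨d, hd⟩ := interior_subset hb
  have hlim : Filter.Tendsto (fun r : ℝ => (1 - r) * (⟪y, a⟫ - c) + r * (⟪y, b⟫ - d))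
      (nhdsWithin 0 (Ioi 0)) (nhds ((1 - 0) * (⟪y, a⟫ - c) + 0 * (⟪y, b⟫ - d))) :=
    (Continuous.tendsto (by fun_prop) 0).mono_left nhdsWithin_le_nhds
  obtain ⟨r, hr, hr0, hr1⟩ := ((hlim.eventually_const_lt (u := 0) (by linarith)).and
    (Ioo_mem_nhdsGT (zero_lt_one (α := ℝ)))).exists
  refine ⟨(1 - r) • a + r • b, ?_, (1 - r) * c + r * d, fun x hx => ?_, ?_⟩
  · exact (convex_barrierCone K).combo_self_interior_mem_interior ⟨c, hc⟩ hb
      (by linarith) hr0 (by ring)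
  · rw [inner_add_right, real_inner_smul_right, real_inner_smul_right]
    have := mul_le_mul_of_nonneg_left (hc x hx) (sub_nonneg.2 hr1.le)
    have := mul_le_mul_of_nonneg_left (hd x hx) hr0.le
    linarith
  · rw [inner_add_right, real_inner_smul_right, real_inner_smul_right]
    linarith

theorem isBounded_of_forall_inner_le [FiniteDimensional ℝ E] {S : Set E}
    (hS : ∀ u : E, ∃ c : ℝ, ∀ x ∈ S, ⟪x, u⟫ ≤ c) : Bornology.IsBounded S := by
  choose c hc using hS
  let b := stdOrthonormalBasis ℝ E
  refine isBounded_iff_forall_norm_le.2 ⟨∑ i, max (c (b i)) (c (-b i)), fun x hx => ?_⟩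
  calc ‖x‖ = ‖∑ i, ⟪b i, x⟫ • b i‖ := by rw [b.sum_repr']
    _ ≤ ∑ i, ‖⟪b i, x⟫ • b i‖ := norm_sum_le _ _
    _ ≤ _ := Finset.sum_le_sum fun i _ => by
      have h1 := hc (b i) x hx
      have h2 := hc (-b i) x hx
      rw [inner_neg_right] at h2
      rw [norm_smul, b.norm_eq_one, mul_one, real_inner_comm, Real.norm_eq_abs]
      exact abs_le'.2 ⟨h1.trans (le_max_left _ _), h2.trans (le_max_right _ _)⟩

theorem isBounded_superlevel_of_mem_interior_barrierCone [FiniteDimensional ℝ E] {K : Set E}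
    {a : E} (ha : a ∈ interior (barrierCone K)) (c : ℝ) :
    Bornology.IsBounded {x ∈ K | c ≤ ⟪x, a⟫} := by
  refine isBounded_of_forall_inner_le fun u => ?_
  have hlim : Filter.Tendsto (fun r : ℝ => a + r • u) (nhdsWithin 0 (Ioi 0))
      (nhds (a + (0 : ℝ) • u)) :=
    (Continuous.tendsto (by fun_prop) 0).mono_left nhdsWithin_le_nhds
  rw [zero_smul, add_zero] at hlim
  obtain ⟨r, ⟨d, hd⟩, hr⟩ := ((hlim.eventually (mem_interior_iff_mem_nhds.1 ha)).and
    self_mem_nhdsWithin).exists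
  refine ⟨(d - c) / r, fun x hx => ?_⟩
  have h := hd x hx.1
  rw [inner_add_right, real_inner_smul_right] at h
  rw [le_div_iff₀ hr]
  linarith [hx.2]

/-- A functional in the interior of the barrier cone attains its maximum at an extreme point. -/
theorem exists_extremePoint_isMax [FiniteDimensional ℝ E] {K : Set E} (hK : IsClosed K)
    (hne : K.Nonempty) {a : E} (ha : a ∈ interior (barrierCone K)) :
    ∃ e ∈ K.extremePoints ℝ, ∀ x ∈ K, ⟪x, a⟫ ≤ ⟪e, a⟫ := by
  obtain ⟨x₀, hx₀⟩ := hne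
  have hcont : Continuous fun x : E => ⟪x, a⟫ := by fun_prop
  have hcl : IsClosed {x ∈ K | ⟪x₀, a⟫ ≤ ⟪x, a⟫} :=
    hK.inter (isClosed_le continuous_const hcont)
  have hcpt := Metric.isCompact_of_isClosed_isBounded hcl
    (isBounded_superlevel_of_mem_interior_barrierCone ha ⟪x₀, a⟫)
  obtain ⟨m, ⟨hmK, hm₀⟩, hm⟩ := hcpt.exists_isMaxOn ⟨x₀, hx₀, le_rfl⟩ hcont.continuousOn
  have hmax : ∀ x ∈ K, ⟪x, a⟫ ≤ ⟪m, a⟫ := fun x hx => by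
    rcases le_total ⟪x₀, a⟫ ⟪x, a⟫ with h | h
    · exact hm ⟨hx, h⟩
    · exact h.trans hm₀
  let l : StrongDual ℝ E := innerSL ℝ a
  have hl (x : E) : l x = ⟪x, a⟫ := real_inner_comm _ _
  have hexp : IsExposed ℝ K (l.toExposed K) :=
    ContinuousLinearMap.toExposed.isExposed
  have hFcpt : IsCompact (l.toExposed K) :=
    hcpt.of_isClosed_subset (hexp.isClosed hK) fun x hx =>
      ⟨hx.1, by simpa only [hl] using hx.2 x₀ hx₀⟩
  obtain ⟨e, he⟩ := hFcpt.extremePoints_nonempty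
    ⟨m, hmK, fun y hy => by simpa only [hl] using hmax y hy⟩
  refine ⟨e, hexp.isExtreme.extremePoints_subset_extremePoints he, fun x hx => ?_⟩
  simpa only [hl] using he.1.2 x hx

theorem exists_ne_zero_orthogonal_barrierCone [FiniteDimensional ℝ E] {K : Set E}
    (hB : ¬(interior (barrierCone K)).Nonempty) :
    ∃ v : E, v ≠ 0 ∧ ∀ a ∈ barrierCone K, ⟪a, v⟫ = 0 := by
  have hspan : Submodule.span ℝ (barrierCone K) ≠ ⊤ := by
    intro h
    refine hB ((convex_barrierCone K).interior_nonempty_iff_affineSpan_eq_top.2 ?_)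
    have h0 : insert (0 : E) (barrierCone K) = barrierCone K :=
      insert_eq_of_mem ⟨0, fun x _ => (inner_zero_right x).le⟩
    have := affineSpan_insert_zero (k := ℝ) (s := barrierCone K)
    rw [h0, h] at this
    exact SetLike.coe_injective this
  rw [Ne, ← Submodule.orthogonal_eq_bot_iff] at hspan
  obtain ⟨v, hv, hv0⟩ := Submodule.exists_mem_ne_zero_of_ne_bot hspan
  exact ⟨v, hv0, fun a ha => hv a (Submodule.subset_span ha)⟩

end Barrier

section Plane

/-- The part of a closed planar cone lying in the quadrant with signs `σ, τ` is generated by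
finitely many of its nonzero vectors. -/
theorem exists_finite_generators_quadrant {C : Set (EuclideanSpace ℝ (Fin 2))} (hC : IsClosed C)
    (hcone : ∀ a ∈ C, ∀ r : ℝ, 0 < r → r • a ∈ C) (σ τ : ℝ) (hσ : σ * σ = 1) (hτ : τ * τ = 1) :
    ∃ G : Set (EuclideanSpace ℝ (Fin 2)), G.Finite ∧ G ⊆ C ∧ (∀ g ∈ G, g ≠ 0) ∧
      ∀ a ∈ C, a ≠ 0 → 0 ≤ σ * a 0 → 0 ≤ τ * a 1 → ∃ g ∈ G, ∃ h ∈ G, ∃ r s : ℝ,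
        0 ≤ r ∧ 0 ≤ s ∧ a = r • g + s • h := by
  let γ : ℝ → EuclideanSpace ℝ (Fin 2) := fun t => !₂[σ * t, τ * (1 - t)]
  have hγ : Continuous γ := by fun_prop
  have hγ0 (t : ℝ) : γ t ≠ 0 := fun h => by
    have h0 : σ * t = 0 := congrArg (fun v : EuclideanSpace ℝ (Fin 2) => v 0) h
    have h1 : τ * (1 - t) = 0 := congrArg (fun v : EuclideanSpace ℝ (Fin 2) => v 1) h
    have : t = 0 := by linear_combination σ * h0 - t * hσ
    have : 1 - t = 0 := by linear_combination τ * h1 - (1 - t) * hτ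
    linarith
  let T : Set ℝ := Icc 0 1 ∩ γ ⁻¹' C
  have hTcpt : IsCompact T := isCompact_Icc.inter_right (hC.preimage hγ)
  have key : ∀ a ∈ C, a ≠ 0 → 0 ≤ σ * a 0 → 0 ≤ τ * a 1 →
      ∃ t ∈ T, ∃ r : ℝ, 0 < r ∧ a = r • γ t := by
    intro a ha ha0 h0 h1
    have hr : 0 < σ * a 0 + τ * a 1 := by
      refine (add_nonneg h0 h1).lt_of_ne' fun h => ha0 ?_
      have e0 : σ * a 0 = 0 := by linarith
      have e1 : τ * a 1 = 0 := by linarith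
      ext i
      fin_cases i
      · change a 0 = 0
        linear_combination σ * e0 - a 0 * hσ
      · change a 1 = 0
        linear_combination τ * e1 - a 1 * hτ
    have hγa : γ (σ * a 0 / (σ * a 0 + τ * a 1)) = (σ * a 0 + τ * a 1)⁻¹ • a := by
      ext i
      fin_cases i
      · change σ * (σ * a 0 / (σ * a 0 + τ * a 1)) = (σ * a 0 + τ * a 1)⁻¹ * a 0
        field_simp
        linear_combination a 0 * hσ
      · change τ * (1 - σ * a 0 / (σ * a 0 + τ * a 1)) = (σ * a 0 + τ * a 1)⁻¹ * a 1
        field_simp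
        linear_combination a 1 * hτ
    refine ⟨σ * a 0 / (σ * a 0 + τ * a 1), ⟨⟨by positivity, ?_⟩, ?_⟩, _, hr, ?_⟩
    · rw [div_le_one hr]
      linarith
    · rw [mem_preimage, hγa]
      exact hcone a ha _ (inv_pos.2 hr)
    · rw [hγa, smul_inv_smul₀ hr.ne']
  rcases T.eq_empty_or_nonempty with hT | hT
  · refine ⟨∅, finite_empty, empty_subset _, by simp, fun a ha ha0 h0 h1 => ?_⟩
    obtain ⟨t, ht, -⟩ := key a ha ha0 h0 h1
    simp [hT] at ht
  obtain ⟨m, hmT, hm⟩ := hTcpt.exists_isLeast hT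
  obtain ⟨M, hMT, hM⟩ := hTcpt.exists_isGreatest hT
  refine ⟨{γ m, γ M}, toFinite _, ?_, ?_, fun a ha ha0 h0 h1 => ?_⟩
  · rintro _ (rfl | rfl)
    exacts [hmT.2, hMT.2]
  · rintro _ (rfl | rfl) <;> exact hγ0 _
  · obtain ⟨t, ht, r, hr, rfl⟩ := key a ha ha0 h0 h1
    obtain ⟨p, q, hp, hq, hpq, hpt⟩ : t ∈ segment ℝ m M := by
      rw [segment_eq_Icc (hm hMT)]
      exact ⟨hm ht, hM ht⟩
    refine ⟨γ m, by simp, γ M, by simp, r * p, r * q, by positivity, by positivity, ?_⟩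
    rw [smul_eq_mul, smul_eq_mul] at hpt
    ext i
    fin_cases i
    · change r * (σ * t) = r * p * (σ * m) + r * q * (σ * M)
      linear_combination -r * σ * hpt
    · change r * (τ * (1 - t)) = r * p * (τ * (1 - m)) + r * q * (τ * (1 - M))
      linear_combination r * τ * hpt - r * τ * hpq

/-- Every closed cone in the plane lies in the convex cone generated by finitely many of its
nonzero vectors. -/
theorem exists_finite_generators {C : Set (EuclideanSpace ℝ (Fin 2))} (hC : IsClosed C)
    (hcone : ∀ a ∈ C, ∀ r : ℝ, 0 < r → r • a ∈ C) :
    ∃ G : Set (EuclideanSpace ℝ (Fin 2)), G.Finite ∧ G ⊆ C ∧ (∀ g ∈ G, g ≠ 0) ∧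
      ∀ a ∈ C, a ≠ 0 → ∃ g ∈ G, ∃ h ∈ G, ∃ r s : ℝ, 0 ≤ r ∧ 0 ≤ s ∧ a = r • g + s • h := by
  have hsign (x : ℝ) : ∃ ε : ℤˣ, 0 ≤ ((ε : ℤ) : ℝ) * x := by
    rcases le_total 0 x with h | h
    · exact ⟨1, by simpa using h⟩
    · exact ⟨-1, by simpa using h⟩
  have hsq (ε : ℤˣ) : ((ε : ℤ) : ℝ) * ((ε : ℤ) : ℝ) = 1 := by
    rcases Int.units_eq_one_or ε with rfl | rfl <;> simp
  choose G hfin hsub hne hgen using fun p : ℤˣ × ℤˣ =>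
    exists_finite_generators_quadrant hC hcone _ _ (hsq p.1) (hsq p.2)
  refine ⟨⋃ p, G p, finite_iUnion hfin, iUnion_subset hsub, fun g hg => ?_, fun a ha ha0 => ?_⟩
  · obtain ⟨p, hp⟩ := mem_iUnion.1 hg
    exact hne p g hp
  · obtain ⟨ε, hε⟩ := hsign (a 0)
    obtain ⟨δ, hδ⟩ := hsign (a 1)
    obtain ⟨g, hg, h, hh, H⟩ := hgen (ε, δ) a ha ha0 hε hδ
    exact ⟨g, mem_iUnion_of_mem _ hg, h, mem_iUnion_of_mem _ hh, H⟩

theorem exists_smul_of_inner_eq_zero {v : EuclideanSpace ℝ (Fin 2)} (hv : v ≠ 0) :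
    ∃ w : EuclideanSpace ℝ (Fin 2), w ≠ 0 ∧ ∀ a, ⟪a, v⟫ = 0 → ∃ c : ℝ, a = c • w := by
  have hpos : v 0 * v 0 + v 1 * v 1 ≠ 0 := fun h => hv <| by
    obtain ⟨h0, h1⟩ := mul_self_add_mul_self_eq_zero.1 h
    ext i
    fin_cases i
    exacts [h0, h1]
  refine ⟨!₂[-v 1, v 0], fun h => hpos ?_, fun a ha =>
    ⟨(a 1 * v 0 - a 0 * v 1) / (v 0 * v 0 + v 1 * v 1), ?_⟩⟩
  · have h0 : -v 1 = 0 := congrArg (fun u : EuclideanSpace ℝ (Fin 2) => u 0) h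
    have h1 : v 0 = 0 := congrArg (fun u : EuclideanSpace ℝ (Fin 2) => u 1) h
    linear_combination v 0 * h1 - v 1 * h0
  · simp only [PiLp.inner_apply, Fin.sum_univ_two, RCLike.inner_apply, conj_trivial] at ha
    ext i
    fin_cases i
    · change a 0 = (a 1 * v 0 - a 0 * v 1) / (v 0 * v 0 + v 1 * v 1) * -v 1
      rw [div_mul_eq_mul_div, eq_div_iff hpos]
      linear_combination v 0 * ha
    · change a 1 = (a 1 * v 0 - a 0 * v 1) / (v 0 * v 0 + v 1 * v 1) * v 0
      rw [div_mul_eq_mul_div, eq_div_iff hpos]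
      linear_combination v 1 * ha

theorem exists_finite_halfPlanes {K : Set (EuclideanSpace ℝ (Fin 2))} (hK : IsClosed K)
    (hconv : Convex ℝ K) (hext : (K.extremePoints ℝ).Finite) :
    ∃ S : Set (EuclideanSpace ℝ (Fin 2) × ℝ), S.Finite ∧
      (∀ p ∈ S, p.1 ≠ 0 ∧ ∀ x ∈ K, ⟪x, p.1⟫ ≤ p.2) ∧
      ∀ y ∉ K, ∃ p ∈ S, p.2 < ⟪y, p.1⟫ := by
  rcases K.eq_empty_or_nonempty with rfl | hne
  · obtain ⟨w, hw⟩ := exists_ne (0 : EuclideanSpace ℝ (Fin 2))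
    refine ⟨{(w, -1), (-w, -1)}, toFinite _, ?_, fun y _ => ?_⟩
    · rintro _ (rfl | rfl) <;> simpa using hw
    · rcases le_total 0 ⟪y, w⟫ with h | h
      · exact ⟨(w, -1), by simp, by change -1 < ⟪y, w⟫; linarith⟩
      · exact ⟨(-w, -1), by simp, by change -1 < ⟪y, -w⟫; rw [inner_neg_right]; linarith⟩
  by_cases hB : (interior (barrierCone K)).Nonempty
  · let N : EuclideanSpace ℝ (Fin 2) → Set (EuclideanSpace ℝ (Fin 2)) :=
      fun e => {a | ∀ x ∈ K, ⟪x, a⟫ ≤ ⟪e, a⟫}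
    have hNcl (e) : IsClosed (N e) := by
      simp only [N, ofPred_forall]
      exact isClosed_biInter fun x _ => isClosed_le (by fun_prop) (by fun_prop)
    have hNcone (e) : ∀ a ∈ N e, ∀ r : ℝ, 0 < r → r • a ∈ N e := fun a ha r hr x hx => by
      rw [real_inner_smul_right, real_inner_smul_right]
      exact mul_le_mul_of_nonneg_left (ha x hx) hr.le
    choose G hfin hsub hG0 hgen using fun e => exists_finite_generators (hNcl e) (hNcone e)
    refine ⟨⋃ e ∈ K.extremePoints ℝ, (fun g => (g, ⟪e, g⟫)) '' G e,
      hext.biUnion fun e _ => (hfin e).image _, fun p hp => ?_, fun y hy => ?_⟩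
    · simp only [mem_iUnion] at hp
      obtain ⟨e, -, g, hg, rfl⟩ := hp
      exact ⟨hG0 e g hg, hsub e hg⟩
    · obtain ⟨a, ha, c, hc, hcy⟩ := exists_separating_inner_mem_interior hK hconv hB hy
      obtain ⟨e, he, hmax⟩ := exists_extremePoint_isMax hK hne ha
      have hey : ⟪e, a⟫ < ⟪y, a⟫ := (hc e he.1).trans_lt hcy
      have ha0 : a ≠ 0 := by
        rintro rfl
        simp at hey
      obtain ⟨g, hg, h, hh, r, s, hr, hs, rfl⟩ := hgen e a hmax ha0
      by_contra! hle
      have hmem (u) (hu : u ∈ G e) : ⟪y, u⟫ ≤ ⟪e, u⟫ :=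
        hle (u, ⟪e, u⟫) (mem_biUnion he (mem_image_of_mem _ hu))
      simp only [inner_add_right, real_inner_smul_right] at hey
      have := mul_le_mul_of_nonneg_left (hmem g hg) hr
      have := mul_le_mul_of_nonneg_left (hmem h hh) hs
      linarith
  · obtain ⟨v, hv, hvB⟩ := exists_ne_zero_orthogonal_barrierCone hB
    obtain ⟨w, hw, hspan⟩ := exists_smul_of_inner_eq_zero hv
    have hsup (u) (hu : u ∈ barrierCone K) : BddAbove ((fun x => ⟪x, u⟫) '' K) := by
      obtain ⟨c, hc⟩ := hu
      exact ⟨c, forall_mem_image.2 hc⟩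
    refine ⟨(fun u => (u, sSup ((fun x => ⟪x, u⟫) '' K))) '' ({w, -w} ∩ barrierCone K),
      (toFinite ({w, -w} : Set _)).inter_of_left _ |>.image _, ?_, fun y hy => ?_⟩
    · rintro _ ⟨u, ⟨hu, huB⟩, rfl⟩
      refine ⟨?_, fun x hx => le_csSup (hsup u huB) (mem_image_of_mem _ hx)⟩
      rcases hu with rfl | rfl
      exacts [hw, neg_ne_zero.2 hw]
    · obtain ⟨a, c, hc, hcy⟩ := exists_separating_inner hK hconv hy
      have hpos : ∃ u ∈ ({w, -w} : Set (EuclideanSpace ℝ (Fin 2))), ∃ r : ℝ, 0 ≤ r ∧ a = r • u := by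
        obtain ⟨r, rfl⟩ := hspan a (hvB a ⟨c, hc⟩)
        rcases le_total 0 r with h | h
        · exact ⟨w, by simp, r, h, rfl⟩
        · exact ⟨-w, by simp, -r, by linarith, by simp⟩
      obtain ⟨u, hu, r, hr, rfl⟩ := hpos
      have hr : 0 < r := by
        refine hr.lt_of_ne' ?_
        rintro rfl
        obtain ⟨x, hx⟩ := hne
        have := hc x hx
        simp at this hcy
        linarith
      have hbound (x) (hx : x ∈ K) : ⟪x, u⟫ ≤ c / r := by
        have := hc x hx
        rw [real_inner_smul_right] at this
        rw [le_div_iff₀ hr]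
        linarith
      refine ⟨_, mem_image_of_mem _ ⟨hu, c / r, hbound⟩, ?_⟩
      refine (csSup_le (hne.image _) (forall_mem_image.2 hbound)).trans_lt ?_
      rw [real_inner_smul_right] at hcy
      rw [div_lt_iff₀ hr]
      linarith

end Plane

/-- Every closed convex subset of `ℝ²` with finitely many extreme points is a polyhedron,
i.e. an intersection of finitely many closed half-planes (with the convention that `ℝ²`
is the intersection of the empty family). -/
theorem polyhedron_of_finitely_many_extreme_points
    (K : Set (EuclideanSpace ℝ (Fin 2))) (hK : IsClosed K) (hconv : Convex ℝ K)
    (hext : (Set.extremePoints ℝ K).Finite) :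
    ∃ (k : ℕ) (a : Fin k → EuclideanSpace ℝ (Fin 2)) (t : Fin k → ℝ),
      (∀ i, a i ≠ 0) ∧ K = ⋂ i, {x | ⟪x, a i⟫ ≤ t i} := by
  obtain ⟨S, hS, hSK, hsep⟩ := exists_finite_halfPlanes hK hconv hext
  have := hS.to_subtype
  obtain ⟨k, ⟨φ⟩⟩ := Finite.exists_equiv_fin S
  refine ⟨k, fun i => (φ.symm i).1.1, fun i => (φ.symm i).1.2,
    fun i => (hSK _ (φ.symm i).2).1, Subset.antisymm (fun x hx => ?_) fun x hx => ?_⟩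
  · exact mem_iInter.2 fun i => (hSK _ (φ.symm i).2).2 x hx
  · by_contra hxK
    obtain ⟨p, hp, hlt⟩ := hsep x hxK
    have h := mem_iInter.1 hx (φ ⟨p, hp⟩)
    simp only [mem_ofPred_eq, Equiv.symm_apply_apply] at h
    exact hlt.not_ge h
end
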